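/- Let M be a finitely generated R-module and let J ⊆ I be an ideal generated by a Q-regular sequence whose images in V are k-linearly independent. Then the following are equivalent: (i) Ext^i_{Q/J}(M,M) ≠ 0 for infinitely many i; (ii) Ext^i_{Q/J}(k,M) ≠ 0 for infinitely many i; (iii) Ext^i_{Q/J}(M,k) ≠ 0 for infinitely many i. (Equivalently, V_R^d(M,M) = V_R^d(k,M) = V_R^d(M).) -/

import Mathlib

open CategoryTheory IsLocalRing

/-- A local ring is regular if its maximal ideal can be generated by a regular sequence. -/
def IsRegularLocal (Q : Type) [CommRing Q] [IsLocalRing Q] : Prop :=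
  ∃ rs : List Q, RingTheory.Sequence.IsRegular Q rs ∧
    Ideal.span {x | x ∈ rs} = maximalIdeal Q

theorem Module.IsTorsionBySet.mono' {Q M : Type} [CommRing Q] [AddCommGroup M] [Module Q M]
    {J I : Ideal Q} (h : Module.IsTorsionBySet Q M (I : Set Q)) (hJI : J ≤ I) :
    Module.IsTorsionBySet Q M (J : Set Q) := fun x a => @h x ⟨a.1, hJI a.2⟩

/-- The `Q ⧸ J`-module structure on a module annihilated by `I ⊇ J`. -/
def modOver {Q : Type} [CommRing Q] {I : Ideal Q} (J : Ideal Q) (hJI : J ≤ I)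
    (M : Type) [AddCommGroup M] [Module Q M]
    (hM : Module.IsTorsionBySet Q M (I : Set Q)) : Module (Q ⧸ J) M :=
  (hM.mono' hJI).module

theorem quot_isTorsionBySet (Q : Type) [CommRing Q] (J : Ideal Q) :
    Module.IsTorsionBySet Q (Q ⧸ J) (J : Set Q) := fun x a => by
  induction x using Quotient.inductionOn with
  | h q =>
    show ((a : Q) • Submodule.Quotient.mk q : Q ⧸ J) = 0
    rw [← Submodule.Quotient.mk_smul, Submodule.Quotient.mk_eq_zero, smul_eq_mul]
    exact Ideal.mul_mem_right q J a.2

/-- The residue field `k = Q/𝔪` as a module over `Q ⧸ J` for any `J ≤ 𝔪`. -/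
def kMod {Q : Type} [CommRing Q] [IsLocalRing Q] (J : Ideal Q) (hJm : J ≤ maximalIdeal Q) :
    Module (Q ⧸ J) (Q ⧸ maximalIdeal Q) :=
  modOver J hJm (Q ⧸ maximalIdeal Q) (quot_isTorsionBySet Q (maximalIdeal Q))

/-- `Ext^i_A(M, N)`, as a module over `A`, for explicitly given module structures. -/
noncomputable def extMod (A : Type) [CommRing A] (M N : Type) [AddCommGroup M] [AddCommGroup N]
    (mM : Module A M) (mN : Module A N) (i : ℕ) : ModuleCat A :=
  ((Ext A (ModuleCat A) i).obj (Opposite.op (@ModuleCat.of A _ M _ mM))).obj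
    (@ModuleCat.of A _ N _ mN)

/-- `Ext^i_A(M, N) ≠ 0` for infinitely many `i`. -/
def extInf (A : Type) [CommRing A] (M N : Type) [AddCommGroup M] [AddCommGroup N]
    (mM : Module A M) (mN : Module A N) : Prop :=
  ∀ n : ℕ, ∃ i, n ≤ i ∧ Nontrivial (extMod A M N mM mN i)

/-- `Ext^i_A(M, N) = 0` for all `i ≫ 0`. -/
def extVan (A : Type) [CommRing A] (M N : Type) [AddCommGroup M] [AddCommGroup N]
    (mM : Module A M) (mN : Module A N) : Prop :=
  ∃ n₀ : ℕ, ∀ i, n₀ ≤ i → Subsingleton (extMod A M N mM mN i)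

/-- The images in `V = I/𝔫I` of the elements `g i` of `I` are `k`-linearly independent. -/
def LinIndepInV (Q : Type) [CommRing Q] [IsLocalRing Q] (I : Ideal Q)
    {d : ℕ} (g : Fin d → Q) : Prop :=
  (∀ i, g i ∈ I) ∧
    ∀ a : Fin d → Q, (∑ i, a i * g i) ∈ maximalIdeal Q * I → ∀ i, a i ∈ maximalIdeal Q

/-- The depth of a module over a local ring: the supremum of the lengths of
regular sequences on the module consisting of elements of the maximal ideal. -/
noncomputable def localDepth (Q : Type) [CommRing Q] [IsLocalRing Q]
    (M : Type) [AddCommGroup M] [Module Q M] : ℕ :=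
  sSup {n | ∃ rs : List Q, rs.length = n ∧ (∀ r ∈ rs, r ∈ maximalIdeal Q) ∧
    RingTheory.Sequence.IsRegular M rs}


section HelperLemmas

open CategoryTheory.Abelian

/-- `Ext^i_A(M,N)` vanishes. -/
def vx (A : Type) [CommRing A] (M N : Type) [AddCommGroup M] [Module A M] [AddCommGroup N]
    [Module A N] (i : ℕ) : Prop :=
  Subsingleton (Abelian.Ext (ModuleCat.of A M) (ModuleCat.of A N) i)

section basic
variable {A : Type} [CommRing A]
variable {X Y Z W : Type} [AddCommGroup X] [AddCommGroup Y] [AddCommGroup Z] [AddCommGroup W]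
  [Module A X] [Module A Y] [Module A Z] [Module A W]

theorem vx_zero {i : ℕ} (h : vx A X Y i) (e : Abelian.Ext (ModuleCat.of A X) (ModuleCat.of A Y) i) :
    e = 0 := by
  have : Subsingleton (Abelian.Ext (ModuleCat.of A X) (ModuleCat.of A Y) i) := h
  exact Subsingleton.elim _ _

theorem vx_mk {i : ℕ}
    (h : ∀ e : Abelian.Ext (ModuleCat.of A X) (ModuleCat.of A Y) i, e = 0) : vx A X Y i :=
  ⟨fun a b => by rw [h a, h b]⟩

/-- short complex of a pair of maps -/
abbrev sc (f : X →ₗ[A] Y) (g : Y →ₗ[A] Z) (h : Function.Exact f g) :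
    ShortComplex (ModuleCat.{0} A) :=
  ShortComplex.mk (ModuleCat.ofHom f) (ModuleCat.ofHom g) (by
    ext x; exact h.apply_apply_eq_zero x)

theorem sc_exact {f : X →ₗ[A] Y} {g : Y →ₗ[A] Z} (h : Function.Exact f g)
    (hf : Function.Injective f) (hg : Function.Surjective g) : (sc f g h).ShortExact where
  exact := (ShortComplex.ShortExact.moduleCat_exact_iff_function_exact _).mpr h
  mono_f := (ModuleCat.mono_iff_injective _).mpr hf
  epi_g := (ModuleCat.epi_iff_surjective _).mpr hg

theorem con2 {f : X →ₗ[A] Y} {g : Y →ₗ[A] Z} (h : Function.Exact f g)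
    (hf : Function.Injective f) (hg : Function.Surjective g)
    {i : ℕ} (h1 : vx A X W i) (h3 : vx A Z W i) : vx A Y W i := by
  refine vx_mk fun e => ?_
  obtain ⟨y, hy⟩ := Ext.contravariant_sequence_exact₂ (sc_exact h hf hg) _ e (vx_zero h1 _)
  rw [← hy, vx_zero h3 y, Ext.comp_zero]

theorem con3 {f : X →ₗ[A] Y} {g : Y →ₗ[A] Z} (h : Function.Exact f g)
    (hf : Function.Injective f) (hg : Function.Surjective g)
    {i : ℕ} (h1 : vx A X W i) (h2 : vx A Y W (i + 1)) : vx A Z W (i + 1) := by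
  refine vx_mk fun e => ?_
  obtain ⟨y, hy⟩ := Ext.contravariant_sequence_exact₃ (sc_exact h hf hg) _ e (vx_zero h2 _)
    (add_comm 1 i)
  rw [← hy, vx_zero h1 y, Ext.comp_zero]

theorem con1 {f : X →ₗ[A] Y} {g : Y →ₗ[A] Z} (h : Function.Exact f g)
    (hf : Function.Injective f) (hg : Function.Surjective g)
    {i : ℕ} (h2 : vx A Y W i) (h3 : vx A Z W (i + 1)) : vx A X W i := by
  refine vx_mk fun e => ?_
  obtain ⟨y, hy⟩ := Ext.contravariant_sequence_exact₁ (sc_exact h hf hg) _ e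
    (add_comm 1 i) (vx_zero h3 _)
  rw [← hy, vx_zero h2 y, Ext.comp_zero]

theorem cov2 {f : X →ₗ[A] Y} {g : Y →ₗ[A] Z} (h : Function.Exact f g)
    (hf : Function.Injective f) (hg : Function.Surjective g)
    {i : ℕ} (h1 : vx A W X i) (h3 : vx A W Z i) : vx A W Y i := by
  refine vx_mk fun e => ?_
  obtain ⟨y, hy⟩ := Ext.covariant_sequence_exact₂ _ (sc_exact h hf hg) e (vx_zero h3 _)
  rw [← hy, vx_zero h1 y, Ext.zero_comp]

theorem cov3 {f : X →ₗ[A] Y} {g : Y →ₗ[A] Z} (h : Function.Exact f g)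
    (hf : Function.Injective f) (hg : Function.Surjective g)
    {i : ℕ} (h1 : vx A W X (i + 1)) (h2 : vx A W Y i) : vx A W Z i := by
  refine vx_mk fun e => ?_
  obtain ⟨y, hy⟩ := Ext.covariant_sequence_exact₃ _ (sc_exact h hf hg) e rfl (vx_zero h1 _)
  rw [← hy, vx_zero h2 y, Ext.zero_comp]

theorem ext_of_vx {f : X →ₗ[A] Y} {g : Y →ₗ[A] Z} (h : Function.Exact f g)
    (hf : Function.Injective f) (hg : Function.Surjective g)
    (h3 : vx A Z W 1) (φ : X →ₗ[A] W) : ∃ ψ : Y →ₗ[A] W, ψ ∘ₗ f = φ := by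
  obtain ⟨y, hy⟩ := Ext.contravariant_sequence_exact₁ (sc_exact h hf hg) _
    (Ext.mk₀ (ModuleCat.ofHom φ)) (add_comm 1 0) (vx_zero h3 _)
  obtain ⟨ψ, rfl⟩ := (Ext.mk₀_bijective _ _).2 y
  rw [Ext.mk₀_comp_mk₀, (Ext.mk₀_bijective _ _).1.eq_iff] at hy
  exact ⟨ψ.hom, congrArg ModuleCat.Hom.hom hy⟩

theorem vx_of_ext {f : X →ₗ[A] Y} {g : Y →ₗ[A] Z} (h : Function.Exact f g)
    (hf : Function.Injective f) (hg : Function.Surjective g)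
    (h2 : vx A Y W 1) (H : ∀ φ : X →ₗ[A] W, ∃ ψ : Y →ₗ[A] W, ψ ∘ₗ f = φ) :
    vx A Z W 1 := by
  refine vx_mk fun e => ?_
  obtain ⟨y, hy⟩ := Ext.contravariant_sequence_exact₃ (sc_exact h hf hg) _ e (vx_zero h2 _)
    (add_comm 1 0)
  obtain ⟨φ, rfl⟩ := (Ext.mk₀_bijective _ _).2 y
  obtain ⟨ψ, hψ⟩ := H φ.hom
  have : φ = (sc f g h).f ≫ ModuleCat.ofHom ψ := by
    ext x; exact (LinearMap.congr_fun hψ x).symm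
  rw [← hy, this, ← Ext.mk₀_comp_mk₀, ShortComplex.ShortExact.extClass_comp_assoc]

end basic

section basic2
variable {A : Type} [CommRing A]
variable {X Y Z W : Type} [AddCommGroup X] [AddCommGroup Y] [AddCommGroup Z] [AddCommGroup W]
  [Module A X] [Module A Y] [Module A Z] [Module A W]

theorem vx_proj [Module.Projective A X] (i : ℕ) : vx A X Y (i + 1) := by
  have : Projective (ModuleCat.of A X) := (IsProjective.iff_projective X).1 inferInstance
  exact vx_mk fun e => e.eq_zero_of_projective

theorem vx_retract_left {i : ℕ} (s : X →ₗ[A] Y) (r : Y →ₗ[A] X) (hrs : r ∘ₗ s = LinearMap.id)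
    (h : vx A Y W i) : vx A X W i := by
  refine vx_mk fun e => ?_
  have : ModuleCat.ofHom s ≫ ModuleCat.ofHom r = 𝟙 (ModuleCat.of A X) := by
    rw [← ModuleCat.ofHom_comp, hrs]; rfl
  rw [← e.mk₀_id_comp, ← this, ← Ext.mk₀_comp_mk₀, Ext.comp_assoc_of_second_deg_zero,
    vx_zero h (Ext.comp _ _ _), Ext.comp_zero]

theorem vx_retract_right {i : ℕ} (s : X →ₗ[A] Y) (r : Y →ₗ[A] X) (hrs : r ∘ₗ s = LinearMap.id)
    (h : vx A W Y i) : vx A W X i := by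
  refine vx_mk fun e => ?_
  have : ModuleCat.ofHom s ≫ ModuleCat.ofHom r = 𝟙 (ModuleCat.of A X) := by
    rw [← ModuleCat.ofHom_comp, hrs]; rfl
  rw [← e.comp_mk₀_id, ← this, ← Ext.mk₀_comp_mk₀, ← Ext.comp_assoc_of_second_deg_zero,
    vx_zero h (Ext.comp _ _ _), Ext.zero_comp]

theorem vx_congr_left {i : ℕ} (e : X ≃ₗ[A] Y) (h : vx A Y W i) : vx A X W i :=
  vx_retract_left e.toLinearMap e.symm.toLinearMap (by ext; simp) h

theorem vx_congr_right {i : ℕ} (e : X ≃ₗ[A] Y) (h : vx A W Y i) : vx A W X i :=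
  vx_retract_right e.toLinearMap e.symm.toLinearMap (by ext; simp) h

theorem vx_subsing_left [Subsingleton X] (i : ℕ) : vx A X W i := by
  refine vx_mk fun e => ?_
  have : 𝟙 (ModuleCat.of A X) = 0 := by ext x; exact Subsingleton.elim _ _
  rw [← e.mk₀_id_comp, this, Ext.mk₀_zero, Ext.zero_comp]

theorem vx_subsing_right [Subsingleton X] (i : ℕ) : vx A W X i := by
  refine vx_mk fun e => ?_
  have : 𝟙 (ModuleCat.of A X) = 0 := by ext x; exact Subsingleton.elim _ _
  rw [← e.comp_mk₀_id, this, Ext.mk₀_zero, Ext.comp_zero]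

theorem vx_iff_ext (i : ℕ) (hi : 1 ≤ i) :
    Subsingleton (extMod A X Y ‹_› ‹_› i) ↔ vx A X Y i := by
  obtain ⟨p, rfl⟩ : ∃ p, i = p + 1 := ⟨i - 1, by omega⟩
  let P := ProjectiveResolution.of (ModuleCat.of A X)
  have e : extMod A X Y ‹_› ‹_› (p + 1) ≅
    (P.complex.linearYonedaObj A (ModuleCat.of A Y)).homology (p + 1) := P.isoExt (p + 1) _
  rw [e.toLinearEquiv.toEquiv.subsingleton_congr, ← ModuleCat.isZero_iff_subsingleton,
    ← HomologicalComplex.exactAt_iff_isZero_homology,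
    HomologicalComplex.exactAt_iff' _ p (p + 1) (p + 2) (by simp) (by simp),
    ShortComplex.moduleCat_exact_iff]
  constructor
  · intro H
    refine vx_mk fun α => ?_
    obtain ⟨f, hf, rfl⟩ := P.extMk_surjective α (p + 2) rfl
    rw [P.extMk_eq_zero_iff f _ _ _ p rfl]
    exact H f hf
  · intro H f hf
    exact (P.extMk_eq_zero_iff f (p + 2) rfl hf p rfl).1 (vx_zero H _)

end basic2

section devissage

theorem smul_id_comp {A : Type} [CommRing A] {X Y : ModuleCat.{0} A} (x : A) {i : ℕ}
    (y : Abelian.Ext X Y i) :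
    (Ext.mk₀ (x • 𝟙 X)).comp y (zero_add i) = x • y := by
  rw [Ext.mk₀_smul, Ext.smul_comp, Ext.mk₀_id_comp]

theorem comp_smul_id {A : Type} [CommRing A] {X Y : ModuleCat.{0} A} (x : A) {i : ℕ}
    (y : Abelian.Ext X Y i) :
    y.comp (Ext.mk₀ (x • 𝟙 Y)) (add_zero i) = x • y := by
  rw [Ext.mk₀_smul, Ext.comp_smul, Ext.comp_mk₀_id]

theorem devissage {A : Type} [CommRing A] [IsNoetherianRing A] [IsLocalRing A]
    (P : (N : Type) → [AddCommGroup N] → [Module A N] → Prop)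
    (hsub : ∀ (N : Type) [AddCommGroup N] [Module A N] [Subsingleton N], P N)
    (hext : ∀ (N₁ N₂ N₃ : Type) [AddCommGroup N₁] [AddCommGroup N₂] [AddCommGroup N₃]
      [Module A N₁] [Module A N₂] [Module A N₃] (f : N₁ →ₗ[A] N₂) (g : N₂ →ₗ[A] N₃),
      Function.Injective f → Function.Surjective g → Function.Exact f g → P N₁ → P N₃ → P N₂)
    (hk : P (A ⧸ maximalIdeal A))
    (hreg : ∀ (N : Type) [AddCommGroup N] [Module A N] [Module.Finite A N] (x : A),
      x ∈ maximalIdeal A → IsSMulRegular N x → P (QuotSMulTop x N) → P N)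
    (N : Type) [AddCommGroup N] [Module A N] [Module.Finite A N] : P N := by
  have equiv : ∀ (N₁ N₂ : Type) [AddCommGroup N₁] [AddCommGroup N₂] [Module A N₁] [Module A N₂]
      (e : N₁ ≃ₗ[A] N₂), P N₁ → P N₂ := fun N₁ N₂ _ _ _ _ e h =>
    hext N₁ N₂ PUnit e.toLinearMap 0 e.injective (Function.surjective_to_subsingleton _)
      ((e.toLinearMap.exact_zero_iff_surjective _).2 e.surjective) h (hsub _)
  suffices H : ∀ I : Ideal A, ∀ (N : Type) [AddCommGroup N] [Module A N] [Module.Finite A N],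
      (∀ a ∈ I, ∀ n : N, a • n = 0) → P N from
    H ⊥ N (by rintro a ha n; rw [Ideal.mem_bot] at ha; simp [ha])
  intro I
  induction I using WellFoundedGT.induction with
  | ind I ih =>
  intro N _ _ _
  induction ‹Module.Finite A N› using
    IsNoetherianRing.induction_on_isQuotientEquivQuotientPrime A with
  | subsingleton N => exact fun _ => hsub N
  | quotient N p e =>
    intro hN
    obtain ⟨p, hp⟩ := p
    refine equiv _ _ e.symm ?_
    have hIp : I ≤ p := by
      intro a ha
      have := hN a ha (e.symm (1 : A ⧸ p))
      rw [← map_smul, map_eq_zero_iff _ e.symm.injective, Algebra.smul_def, mul_one] at this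
      exact Ideal.Quotient.eq_zero_iff_mem.1 this
    by_cases hpm : p = maximalIdeal A
    · subst hpm; exact hk
    · obtain ⟨x, hxm, hxp⟩ := SetLike.exists_of_lt
        (lt_of_le_of_ne (IsLocalRing.le_maximalIdeal hp.ne_top) hpm)
      refine hreg (A ⧸ p) x hxm ?_ ?_
      · rw [isSMulRegular_iff_right_eq_zero_of_smul]
        intro y hy
        obtain ⟨y, rfl⟩ := Ideal.Quotient.mk_surjective y
        change Ideal.Quotient.mk p (x * y) = 0 at hy
        rw [Ideal.Quotient.eq_zero_iff_mem] at hy ⊢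
        exact (hp.mem_or_mem hy).resolve_left hxp
      · refine ih (p ⊔ Ideal.span {x}) ?_ _ ?_
        · refine lt_of_le_of_lt hIp (lt_of_le_of_ne le_sup_left fun h => hxp ?_)
          rw [h]; exact Ideal.mem_sup_right (Ideal.mem_span_singleton_self x)
        · intro a ha n
          have : p ⊔ Ideal.span {x} ≤ Module.annihilator A (QuotSMulTop x (A ⧸ p)) := by
            refine sup_le ?_ ?_
            · intro b hb
              rw [Module.mem_annihilator]
              intro m
              obtain ⟨m, rfl⟩ := Submodule.Quotient.mk_surjective _ m
              obtain ⟨m, rfl⟩ := Ideal.Quotient.mk_surjective m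
              rw [← Submodule.Quotient.mk_smul]
              have : b • Ideal.Quotient.mk p m = 0 := by
                change Ideal.Quotient.mk p (b * m) = 0
                exact Ideal.Quotient.eq_zero_iff_mem.2 (Ideal.mul_mem_right _ _ hb)
              rw [this, Submodule.Quotient.mk_zero]
            · rw [Ideal.span_singleton_le_iff_mem]
              exact QuotSMulTop.mem_annihilator _ _
          exact Module.mem_annihilator.1 (this ha) n
  | exact N₁ N₂ N₃ f g hf hg hfg h₁ h₃ =>
    intro hN
    refine hext N₁ N₂ N₃ f g hf hg hfg (h₁ fun a ha n => hf ?_) (h₃ fun a ha n => ?_)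
    · rw [map_smul, hN a ha, map_zero]
    · obtain ⟨n, rfl⟩ := hg n
      rw [← map_smul, hN a ha, map_zero]

variable {A : Type} [CommRing A] [IsNoetherianRing A] [IsLocalRing A]

theorem vx_of_smul {M N : Type} [AddCommGroup M] [AddCommGroup N] [Module A M] [Module A N]
    [Module.Finite A M] [Module.Finite A N] {i : ℕ} (x : A) (hx : x ∈ maximalIdeal A)
    (h : ∀ e : Abelian.Ext (ModuleCat.of A M) (ModuleCat.of A N) i, ∃ e', e = x • e') :
    vx A M N i := by
  by_contra hn
  have ntr : Nontrivial (Abelian.Ext (ModuleCat.of A M) (ModuleCat.of A N) i) :=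
    not_subsingleton_iff_nontrivial.1 hn
  have : Module.Finite A (Abelian.Ext (ModuleCat.of A M) (ModuleCat.of A N) i) := inferInstance
  have : x ∈ (Module.annihilator A
      (Abelian.Ext (ModuleCat.of A M) (ModuleCat.of A N) i)).jacobson :=
    (IsLocalRing.maximalIdeal_le_jacobson _) hx
  refine Submodule.top_ne_pointwise_smul_of_mem_jacobson_annihilator this ?_
  rw [eq_comm, eq_top_iff]
  intro y hy
  obtain ⟨z, rfl⟩ := h y
  exact Submodule.smul_mem_pointwise_smul _ _ ⊤ trivial

theorem bass {Y : Type} [AddCommGroup Y] [Module A Y] [Module.Finite A Y] (n : ℕ)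
    (h : ∀ i, n ≤ i → vx A (A ⧸ maximalIdeal A) Y i)
    (N : Type) [AddCommGroup N] [Module A N] [Module.Finite A N] : ∀ i, n ≤ i → vx A N Y i := by
  refine devissage (A := A) (fun N _ _ => ∀ i, n ≤ i → vx A N Y i) (fun N _ _ _ i _ => vx_subsing_left i)
    ?_ h ?_ N
  · intro N₁ N₂ N₃ _ _ _ _ _ _ f g hf hg hfg h1 h3 i hi
    exact con2 hfg hf hg (h1 i hi) (h3 i hi)
  · intro N _ _ _ x hx hreg hq i hi
    refine vx_of_smul x hx fun e => ?_
    obtain ⟨y, hy⟩ := Ext.contravariant_sequence_exact₁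
      (S := (ModuleCat.of A N).smulShortComplex x)
      (IsSMulRegular.smulShortComplex_shortExact hreg) (ModuleCat.of A Y) e
      (add_comm 1 i) (vx_zero (hq (i + 1) (by omega)) _)
    exact ⟨y, hy.symm.trans (smul_id_comp x y)⟩

theorem bass' {Y : Type} [AddCommGroup Y] [Module A Y] [Module.Finite A Y] (n : ℕ)
    (h : ∀ i, n ≤ i → vx A Y (A ⧸ maximalIdeal A) i)
    (N : Type) [AddCommGroup N] [Module A N] [Module.Finite A N] : ∀ i, n ≤ i → vx A Y N i := by
  refine devissage (A := A) (fun N _ _ => ∀ i, n ≤ i → vx A Y N i) (fun N _ _ _ i _ => vx_subsing_right i)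
    ?_ h ?_ N
  · intro N₁ N₂ N₃ _ _ _ _ _ _ f g hf hg hfg h1 h3 i hi
    exact cov2 hfg hf hg (h1 i hi) (h3 i hi)
  · intro N _ _ _ x hx hreg hq i hi
    refine vx_of_smul x hx fun e => ?_
    obtain ⟨y, hy⟩ := Ext.covariant_sequence_exact₂ (ModuleCat.of A Y)
      (S := (ModuleCat.of A N).smulShortComplex x)
      (IsSMulRegular.smulShortComplex_shortExact hreg) e (vx_zero (hq i (by omega)) _)
    exact ⟨y, hy.symm.trans (comp_smul_id x y)⟩

end devissage

section base

/-- The inductive property of the ring. -/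
def SA (A : Type) [CommRing A] : Prop :=
  (∀ (M : Type) [AddCommGroup M] [Module A M] [Module.Finite A M],
    (∃ n, ∀ i, n ≤ i → vx A M M i) → ∃ n, HasProjectiveDimensionLT (ModuleCat.of A M) n) ∧
  (∃ n, ∀ (N Y : Type) [AddCommGroup N] [Module A N] [Module.Finite A N]
    [AddCommGroup Y] [Module A Y] [Module.Finite A Y] [Module.Projective A Y],
    ∀ i, n ≤ i → vx A N Y i)

theorem pd_vx {A M N : Type} [CommRing A] [AddCommGroup M] [Module A M] [AddCommGroup N]
    [Module A N] {n : ℕ} (h : HasProjectiveDimensionLT (ModuleCat.of A M) n) {i : ℕ}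
    (hi : n ≤ i) : vx A M N i :=
  HasProjectiveDimensionLT.subsingleton (ModuleCat.of A M) n i hi _

theorem SA_base {A : Type} [CommRing A] [IsLocalRing A] [IsNoetherianRing A] (rs : List A)
    (h : RingTheory.Sequence.IsWeaklyRegular A rs) (hm : Ideal.ofList rs = maximalIdeal A) :
    SA A := by
  have h1 := ModuleCat.projectiveDimension_quotient_eq_add_length_of_isWeaklyRegular
    (ModuleCat.of A A) rs h (fun r hr => by
      rw [← hm]; exact Ideal.subset_span hr)
  have e : (A ⧸ (Ideal.ofList rs • ⊤ : Submodule A A)) ≃ₗ[A] (A ⧸ maximalIdeal A) :=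
    Submodule.quotEquivOfEq _ _ (by rw [hm]; simp)
  have h2 : HasProjectiveDimensionLT (ModuleCat.of A A) 1 := by
    rw [← projective_iff_hasProjectiveDimensionLT_one]
    exact (IsProjective.iff_projective A).1 inferInstance
  have h3 : projectiveDimension (ModuleCat.of A A) ≤ (0 : ℕ) := by
    rw [projectiveDimension_le_iff]; exact h2
  have h4 : HasProjectiveDimensionLT
      (ModuleCat.of A (A ⧸ (Ideal.ofList rs • ⊤ : Submodule A A))) (rs.length + 1) := by
    have : projectiveDimension (ModuleCat.of A (A ⧸ (Ideal.ofList rs • ⊤ : Submodule A A)))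
        ≤ (rs.length : ℕ) := by
      refine h1.le.trans ?_
      calc _ ≤ ((0 : ℕ) : WithBot ℕ∞) + rs.length := by gcongr
        _ = _ := by simp
    rwa [projectiveDimension_le_iff] at this
  have key : ∀ (N Y : Type) [AddCommGroup N] [Module A N] [Module.Finite A N]
      [AddCommGroup Y] [Module A Y] [Module.Finite A Y] (i : ℕ), rs.length + 1 ≤ i → vx A N Y i := by
    intro N Y _ _ _ _ _ _
    refine bass _ (fun i hi => vx_congr_left e.symm (pd_vx h4 hi)) N
  refine ⟨fun M _ _ _ _ => ⟨rs.length + 1, ?_⟩, rs.length + 1, fun N Y _ _ _ _ _ _ _ => key N Y⟩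
  exact ModuleCat.hasProjectiveDimensionLT_of_forall_finite _ _ fun L _ => key M L _ le_rfl

theorem SA_base' {Q A : Type} [CommRing Q] [IsLocalRing Q] [IsNoetherianRing Q] [CommRing A]
    [Algebra Q A] (hQ : IsRegularLocal Q) (hb : Function.Bijective (algebraMap Q A)) : SA A := by
  obtain ⟨rs, hrs, hm⟩ := hQ
  have : Nontrivial A := hb.1.nontrivial
  have hl : IsLocalRing A := IsLocalRing.of_surjective' (algebraMap Q A) hb.2
  have : IsNoetherianRing A := isNoetherianRing_of_surjective Q A (algebraMap Q A) hb.2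
  let e : Q ≃ₗ[Q] A := LinearEquiv.ofBijective (Algebra.linearMap Q A) hb
  refine SA_base (rs.map (algebraMap Q A)) ?_ ?_
  · rw [RingTheory.Sequence.isWeaklyRegular_map_algebraMap_iff, ← e.isWeaklyRegular_congr]
    exact hrs.1
  · rw [← Ideal.map_ofList]
    have : Ideal.ofList rs = maximalIdeal Q := hm
    rw [this]
    refine IsLocalRing.eq_maximalIdeal ?_
    exact Ideal.map_isMaximal_of_equiv (RingEquiv.ofBijective (algebraMap Q A) hb)

end base

section red

/-- `q` exhibits `K'` as `K / xK`. -/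
structure IsRed {B K K' : Type} [CommRing B] [AddCommGroup K] [Module B K] [AddCommGroup K']
    [Module B K'] (x : B) (q : K →ₗ[B] K') : Prop where
  surj : Function.Surjective q
  ker : ∀ k, q k = 0 ↔ ∃ k', k = x • k'

variable {A B : Type} [CommRing A] [CommRing B] [Algebra B A]

theorem exists_red (hs : Function.Surjective (algebraMap B A)) {x : B}
    (hk : ∀ b, algebraMap B A b = 0 ↔ ∃ b', b = x * b') (K : Type) [AddCommGroup K] [Module B K] :
    ∃ (K' : Type) (_ : AddCommGroup K') (_ : Module A K') (_ : Module B K')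
      (_ : IsScalarTower B A K') (q : K →ₗ[B] K'), IsRed x q := by
  refine ⟨TensorProduct B A K, inferInstance, inferInstance, inferInstance, inferInstance,
    TensorProduct.mk B A K 1, ?_, ?_⟩
  · intro y
    induction y using TensorProduct.induction_on with
    | zero => exact ⟨0, by simp⟩
    | tmul a k =>
      obtain ⟨b, rfl⟩ := hs a
      refine ⟨b • k, ?_⟩
      rw [TensorProduct.mk_apply, TensorProduct.tmul_smul, TensorProduct.smul_tmul',
        Algebra.smul_def, mul_one]
    | add y z hy hz =>
      obtain ⟨a, rfl⟩ := hy
      obtain ⟨b, rfl⟩ := hz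
      exact ⟨a + b, map_add _ _ _⟩
  · have he : Function.Exact (LinearMap.lsmul B B x) (Algebra.linearMap B A) := by
      intro b
      rw [Algebra.linearMap_apply, hk]
      exact ⟨fun ⟨b', h⟩ => ⟨b', h.symm⟩, fun ⟨b', h⟩ => ⟨b', h.symm⟩⟩
    have he' := rTensor_exact K he hs
    intro k
    have h1 := he' ((TensorProduct.lid B K).symm k)
    have h2 : (LinearMap.rTensor K (Algebra.linearMap B A)) ((TensorProduct.lid B K).symm k) =
      TensorProduct.mk B A K 1 k := by simp
    rw [h2] at h1
    rw [h1]
    constructor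
    · rintro ⟨y, hy⟩
      refine ⟨TensorProduct.lid B K y, ?_⟩
      have : ∀ y, TensorProduct.lid B K ((LinearMap.rTensor K (LinearMap.lsmul B B x)) y) =
          x • TensorProduct.lid B K y := by
        intro y
        induction y using TensorProduct.induction_on with
        | zero => simp
        | tmul a k => simp [mul_smul]
        | add y z hy hz => simp [hy, hz]
      rw [← this, hy, LinearEquiv.apply_symm_apply]
    · rintro ⟨k', rfl⟩
      refine ⟨(1 : B) ⊗ₜ k', ?_⟩
      simp [TensorProduct.smul_tmul']

variable {x : B}

section
variable {K K' : Type} [AddCommGroup K] [AddCommGroup K'] [Module B K] [Module B K'] [Module A K']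
  [IsScalarTower B A K'] {q : K →ₗ[B] K'}

theorem x_smul_zero (hk : algebraMap B A x = 0) {X : Type} [AddCommGroup X] [Module B X]
    [Module A X] [IsScalarTower B A X] (y : X) : x • y = 0 := by
  rw [← algebraMap_smul A, hk, zero_smul]

theorem IsRed.finite [Module.Finite B K] (hq : IsRed x q) : Module.Finite A K' := by
  have : Module.Finite B K' := Module.Finite.of_surjective q hq.surj
  exact Module.Finite.of_restrictScalars_finite B A K'

theorem IsRed.lift (hs : Function.Surjective (algebraMap B A)) (hk : algebraMap B A x = 0)
    (hq : IsRed x q) {X : Type} [AddCommGroup X] [Module B X]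
    [Module A X] [IsScalarTower B A X] (φ : K →ₗ[B] X) :
    ∃ ψ : K' →ₗ[A] X, ∀ k, ψ (q k) = φ k := by
  have h : LinearMap.ker q ≤ LinearMap.ker φ := by
    intro k h
    obtain ⟨k', rfl⟩ := (hq.ker k).1 h
    rw [LinearMap.mem_ker, map_smul, x_smul_zero hk]
  let e := q.quotKerEquivOfSurjective hq.surj
  let ψ : K' →ₗ[B] X := (LinearMap.ker q).liftQ φ h ∘ₗ e.symm.toLinearMap
  refine ⟨ψ.extendScalarsOfSurjective hs, fun k => ?_⟩
  change (LinearMap.ker q).liftQ φ h (e.symm (q k)) = φ k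
  have : e.symm (q k) = Submodule.Quotient.mk k := by
    rw [LinearEquiv.symm_apply_eq]; rfl
  rw [this]; rfl

theorem IsRed.projective (hs : Function.Surjective (algebraMap B A)) (hk : algebraMap B A x = 0)
    (hq : IsRed x q) [Module.Projective B K] : Module.Projective A K' := by
  refine Module.Projective.of_lifting_property'' fun f hf => ?_
  obtain ⟨φ, hφ⟩ := Module.projective_lifting_property (f.restrictScalars B) q hf
  obtain ⟨ψ, hψ⟩ := hq.lift hs hk φ
  refine ⟨ψ, LinearMap.ext fun y => ?_⟩
  obtain ⟨k, rfl⟩ := hq.surj y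
  rw [LinearMap.comp_apply, hψ]
  exact LinearMap.congr_fun hφ k

end

section ses
variable {K₁ K₂ K₃ L₁ L₂ L₃ : Type} [AddCommGroup K₁] [AddCommGroup K₂] [AddCommGroup K₃]
  [AddCommGroup L₁] [AddCommGroup L₂] [AddCommGroup L₃] [Module B K₁] [Module B K₂] [Module B K₃]
  [Module B L₁] [Module B L₂] [Module B L₃] [Module A L₁] [Module A L₂] [Module A L₃]
  [IsScalarTower B A L₁] [IsScalarTower B A L₂] [IsScalarTower B A L₃]
  {q₁ : K₁ →ₗ[B] L₁} {q₂ : K₂ →ₗ[B] L₂} {q₃ : K₃ →ₗ[B] L₃}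

theorem red_ses (hs : Function.Surjective (algebraMap B A)) (hk : algebraMap B A x = 0)
    (h₁ : IsRed x q₁) (h₂ : IsRed x q₂) (h₃ : IsRed x q₃) (i : K₁ →ₗ[B] K₂) (p : K₂ →ₗ[B] K₃)
    (hi : Function.Injective i) (hp : Function.Surjective p) (hip : Function.Exact i p)
    (hx : IsSMulRegular K₃ x) :
    ∃ (i' : L₁ →ₗ[A] L₂) (p' : L₂ →ₗ[A] L₃), Function.Exact i' p' ∧ Function.Injective i' ∧
      Function.Surjective p' ∧ (∀ k, i' (q₁ k) = q₂ (i k)) ∧ ∀ k, p' (q₂ k) = q₃ (p k) := by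
  obtain ⟨i', hi'⟩ := h₁.lift hs hk (q₂ ∘ₗ i)
  obtain ⟨p', hp'⟩ := h₂.lift hs hk (q₃ ∘ₗ p)
  simp only [LinearMap.comp_apply] at hi' hp'
  have hx0 : ∀ k : K₃, x • k = 0 → k = 0 := fun k => hx.right_eq_zero_of_smul
  refine ⟨i', p', ?_, ?_, ?_, hi', hp'⟩
  · intro y
    obtain ⟨k, rfl⟩ := h₂.surj y
    rw [hp', h₃.ker]
    constructor
    · rintro ⟨k₃, hk₃⟩
      obtain ⟨k₂, rfl⟩ := hp k₃
      rw [← map_smul, ← sub_eq_zero, ← map_sub] at hk₃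
      obtain ⟨k₁, hk₁⟩ := (hip _).1 hk₃
      refine ⟨q₁ k₁, ?_⟩
      rw [hi', hk₁, map_sub, sub_eq_self, h₂.ker]
      exact ⟨k₂, rfl⟩
    · rintro ⟨y, hy⟩
      obtain ⟨k₁, rfl⟩ := h₁.surj y
      rw [hi', ← sub_eq_zero, ← map_sub, h₂.ker] at hy
      obtain ⟨k₂, hk₂⟩ := hy
      refine ⟨-p k₂, ?_⟩
      have := congrArg p hk₂
      rw [map_sub, hip.apply_apply_eq_zero, zero_sub, map_smul] at this
      rw [smul_neg, ← this, neg_neg]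
  · rw [injective_iff_map_eq_zero]
    intro y hy
    obtain ⟨k, rfl⟩ := h₁.surj y
    rw [hi', h₂.ker] at hy
    obtain ⟨k₂, hk₂⟩ := hy
    have : p k₂ = 0 := hx0 _ (by rw [← map_smul, ← hk₂, hip.apply_apply_eq_zero])
    obtain ⟨k₁, rfl⟩ := (hip _).1 this
    rw [← map_smul] at hk₂
    exact (h₁.ker _).2 ⟨k₁, hi hk₂⟩
  · intro y
    obtain ⟨k₃, rfl⟩ := h₃.surj y
    obtain ⟨k₂, rfl⟩ := hp k₃
    exact ⟨q₂ k₂, hp' k₂⟩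

end ses

theorem regular_free (hx : IsSMulRegular B x) (F : Type) [AddCommGroup F] [Module B F]
    [Module.Free B F] : IsSMulRegular F x := by
  have e := (Module.Free.chooseBasis B F).repr
  rw [e.isSMulRegular_congr]
  intro a b h
  ext i
  exact hx (by simpa using DFunLike.congr_fun h i)

theorem regular_sub {F K : Type} [AddCommGroup F] [Module B F] [AddCommGroup K] [Module B K]
    (i : K →ₗ[B] F) (hi : Function.Injective i) (hx : IsSMulRegular F x) : IsSMulRegular K x := by
  intro a b h
  refine hi (hx ?_)
  have := congrArg i h
  simpa using this

theorem alpha [IsNoetherianRing B] (hs : Function.Surjective (algebraMap B A))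
    (hk : ∀ b, algebraMap B A b = 0 ↔ ∃ b', b = x * b') (hx : IsSMulRegular B x)
    {N : Type} [AddCommGroup N] [Module B N] [Module A N] [IsScalarTower B A N] (n : ℕ)
    {K L : Type} [AddCommGroup K] [Module B K] [Module.Finite B K] [AddCommGroup L]
    [Module A L] [Module B L] [IsScalarTower B A L] (hxK : IsSMulRegular K x) {q : K →ₗ[B] L}
    (hq : IsRed x q) (h : vx A L N (n + 1)) : vx B K N (n + 1) := by
  have hx0 : algebraMap B A x = 0 := (hk x).2 ⟨1, by simp⟩
  induction n generalizing K L with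
  | zero =>
    obtain ⟨F, _, _, _, _, p, hp⟩ := Module.exists_finite_presentation B K
    obtain ⟨F', _, _, _, _, qF, hqF⟩ := exists_red hs hk F
    obtain ⟨L', _, _, _, _, q', hq'⟩ := exists_red hs hk (LinearMap.ker p)
    obtain ⟨i', p', he, hi', hp', hi'q, hp'q⟩ := red_ses hs hx0 hq' hqF hq (LinearMap.ker p).subtype p
      Subtype.val_injective hp p.exact_subtype_ker_map hxK
    refine vx_of_ext p.exact_subtype_ker_map Subtype.val_injective hp (vx_proj 0) fun φ => ?_
    obtain ⟨φ', hφ'⟩ := hq'.lift hs hx0 φ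
    obtain ⟨ψ, hψ⟩ := ext_of_vx he hi' hp' h φ'
    refine ⟨ψ.restrictScalars B ∘ₗ qF, LinearMap.ext fun k => ?_⟩
    rw [← hφ', ← hψ]
    exact congrArg ψ (hi'q k).symm
  | succ n ih =>
    obtain ⟨F, _, _, _, _, p, hp⟩ := Module.exists_finite_presentation B K
    obtain ⟨F', _, _, _, _, qF, hqF⟩ := exists_red hs hk F
    obtain ⟨L', _, _, _, _, q', hq'⟩ := exists_red hs hk (LinearMap.ker p)
    obtain ⟨i', p', he, hi', hp', hi'q, hp'q⟩ := red_ses hs hx0 hq' hqF hq (LinearMap.ker p).subtype p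
      Subtype.val_injective hp p.exact_subtype_ker_map hxK
    have := hqF.projective hs hx0
    have h1 : vx A L' N (n + 1) := con1 he hi' hp' (vx_proj n) h
    have h2 := ih (regular_sub (LinearMap.ker p).subtype Subtype.val_injective
      (regular_free hx F)) hq' h1
    exact con3 p.exact_subtype_ker_map Subtype.val_injective hp h2 (vx_proj (n + 1))

theorem beta [IsNoetherianRing B] (hs : Function.Surjective (algebraMap B A))
    (hk : ∀ b, algebraMap B A b = 0 ↔ ∃ b', b = x * b') (hx : IsSMulRegular B x) (n : ℕ)
    {K L : Type} [AddCommGroup K] [Module B K] [Module.Finite B K] [AddCommGroup L]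
    [Module A L] [Module B L] [IsScalarTower B A L] (hxK : IsSMulRegular K x) {q : K →ₗ[B] L}
    (hq : IsRed x q) (h : HasProjectiveDimensionLT (ModuleCat.of B K) (n + 1)) :
    HasProjectiveDimensionLT (ModuleCat.of A L) (n + 1) := by
  have hx0 : algebraMap B A x = 0 := (hk x).2 ⟨1, by simp⟩
  induction n generalizing K L with
  | zero =>
    rw [zero_add, ← projective_iff_hasProjectiveDimensionLT_one] at h ⊢
    have : Module.Projective B K := (IsProjective.iff_projective K).2 h
    exact (IsProjective.iff_projective L).1 (hq.projective hs hx0)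
  | succ n ih =>
    obtain ⟨F, _, _, _, _, p, hp⟩ := Module.exists_finite_presentation B K
    obtain ⟨F', _, _, _, _, qF, hqF⟩ := exists_red hs hk F
    obtain ⟨L', _, _, _, _, q', hq'⟩ := exists_red hs hk (LinearMap.ker p)
    obtain ⟨i', p', he, hi', hp', hi'q, hp'q⟩ := red_ses hs hx0 hq' hqF hq (LinearMap.ker p).subtype p
      Subtype.val_injective hp p.exact_subtype_ker_map hxK
    have := hqF.projective hs hx0
    have s1 := sc_exact p.exact_subtype_ker_map Subtype.val_injective hp
    have s2 := sc_exact he hi' hp'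
    have p1 : Projective (ModuleCat.of B F) := (IsProjective.iff_projective F).1 inferInstance
    have p2 : Projective (ModuleCat.of A F') := (IsProjective.iff_projective F').1 inferInstance
    refine (s2.hasProjectiveDimensionLT_X₃_iff n p2).2 ?_
    exact ih (regular_sub (LinearMap.ker p).subtype Subtype.val_injective
      (regular_free hx F)) hq' ((s1.hasProjectiveDimensionLT_X₃_iff n p1).1 h)

end red

section chi

variable {A : Type} [CommRing A]

theorem chi_inj {M K L F : Type} [AddCommGroup M] [AddCommGroup K] [AddCommGroup L]
    [AddCommGroup F] [Module A M] [Module A K] [Module A L] [Module A F] [Module.Projective A F]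
    {j : M →ₗ[A] K} {π : K →ₗ[A] L} (h1 : Function.Exact j π) (hj : Function.Injective j)
    (hπ : Function.Surjective π) {ι : L →ₗ[A] F} {p : F →ₗ[A] M} (h2 : Function.Exact ι p)
    (hι : Function.Injective ι) (hp : Function.Surjective p) (m : ℕ)
    (hK : HasProjectiveDimensionLT (ModuleCat.of A K) m) :
    ∃ χ : Abelian.Ext (ModuleCat.of A M) (ModuleCat.of A M) 2, ∀ (N : Type) [AddCommGroup N]
      [Module A N] (i : ℕ), m ≤ i → ∀ α : Abelian.Ext (ModuleCat.of A M) (ModuleCat.of A N) i,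
      χ.comp α (add_comm 2 i) = 0 → α = 0 := by
  refine ⟨(sc_exact h2 hι hp).extClass.comp (sc_exact h1 hj hπ).extClass rfl,
    fun N _ _ i hi α hα => ?_⟩
  rw [Ext.comp_assoc _ _ _ rfl (add_comm 1 i) (by omega)] at hα
  have hβ : (sc_exact h1 hj hπ).extClass.comp α (add_comm 1 i) = 0 := by
    obtain ⟨y, hy⟩ := Ext.contravariant_sequence_exact₁ (sc_exact h2 hι hp) _ _ _ hα
    rw [← hy, vx_zero (vx_proj (A := A) (X := F) (Y := N) i) y, Ext.comp_zero]
  obtain ⟨y, hy⟩ := Ext.contravariant_sequence_exact₁ (sc_exact h1 hj hπ) _ _ _ hβ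
  rw [← hy, vx_zero (pd_vx hK hi) y, Ext.comp_zero]

theorem chi_pd [IsNoetherianRing A] {M : Type} [AddCommGroup M] [Module A M] [Module.Finite A M]
    {m n : ℕ}
    (χ : Abelian.Ext (ModuleCat.of A M) (ModuleCat.of A M) 2)
    (hχ : ∀ (N : Type) [AddCommGroup N]
      [Module A N] (i : ℕ), m ≤ i → ∀ α : Abelian.Ext (ModuleCat.of A M) (ModuleCat.of A N) i,
      χ.comp α (add_comm 2 i) = 0 → α = 0)
    (h : ∀ i, n ≤ i → vx A M M i) : HasProjectiveDimensionLT (ModuleCat.of A M) m := by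
  have key : ∀ j : ℕ, ∃ χ' : Abelian.Ext (ModuleCat.of A M) (ModuleCat.of A M) (2 * j),
      ∀ (N : Type) [AddCommGroup N]
      [Module A N] (i : ℕ), m ≤ i → ∀ α : Abelian.Ext (ModuleCat.of A M) (ModuleCat.of A N) i,
      χ'.comp α rfl = 0 → α = 0 := by
    intro j
    induction j with
    | zero =>
      refine ⟨Ext.mk₀ (𝟙 _), fun N _ _ i hi α hα => ?_⟩
      have : ∀ (l : ℕ) (hl : 0 + i = l), (Ext.mk₀ (𝟙 (ModuleCat.of A M))).comp α hl = 0 →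
          α = 0 := by
        intro l hl
        obtain rfl : i = l := by omega
        rw [Ext.mk₀_id_comp]; exact id
      exact this _ _ hα
    | succ j ih =>
      obtain ⟨χ', h'⟩ := ih
      refine ⟨χ'.comp χ (by omega), fun N _ _ i hi α hα => ?_⟩
      rw [Ext.comp_assoc _ _ _ (by omega) (add_comm 2 i) (by omega)] at hα
      have : ∀ (l : ℕ) (hl : 2 * j + (i + 2) = l), χ'.comp (χ.comp α (add_comm 2 i)) hl = 0 →
          α = 0 := by
        intro l hl
        subst hl
        intro h''
        exact hχ N i hi α (h' N (i + 2) (by omega) _ h'')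
      exact this _ _ hα
  refine ModuleCat.hasProjectiveDimensionLT_of_forall_finite _ _ fun N _ => ?_
  obtain ⟨χ', h'⟩ := key n
  refine vx_mk (Y := N) fun α => h' N m le_rfl α ?_
  rw [vx_zero (h (2 * n) (by omega)) χ', Ext.zero_comp]

end chi

section stepa
variable {A B : Type} [CommRing A] [CommRing B] [Algebra B A] {x : B}

theorem four_term (hs : Function.Surjective (algebraMap B A)) (hx0 : algebraMap B A x = 0)
    {F K M F' K' : Type} [AddCommGroup F] [AddCommGroup K] [AddCommGroup M] [AddCommGroup F']
    [AddCommGroup K'] [Module B F] [Module B K] [Module B M] [Module B F'] [Module B K']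
    [Module A M] [Module A F'] [Module A K'] [IsScalarTower B A M] [IsScalarTower B A F']
    [IsScalarTower B A K'] (hxF : IsSMulRegular F x) {ι : K →ₗ[B] F} {p : F →ₗ[B] M}
    (hιp : Function.Exact ι p) (hι : Function.Injective ι) (hp : Function.Surjective p)
    {qF : F →ₗ[B] F'} {qK : K →ₗ[B] K'} (hqF : IsRed x qF) (hqK : IsRed x qK) :
    ∃ (p' : F' →ₗ[A] M) (j : M →ₗ[A] K') (π : K' →ₗ[A] LinearMap.ker p'),
      Function.Surjective p' ∧ Function.Exact j π ∧ Function.Injective j ∧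
        Function.Surjective π := by
  obtain ⟨p', hp'⟩ := hqF.lift hs hx0 p
  obtain ⟨ι', hι'⟩ := hqK.lift hs hx0 (qF ∘ₗ ι)
  simp only [LinearMap.comp_apply] at hι'
  have hex : ∀ f : F, ∃ k : K, ι k = x • f := fun f => (hιp (x • f)).1 (by
    rw [map_smul, x_smul_zero hx0])
  choose t ht using hex
  have hθ : ∃ θ : F →ₗ[B] K, ∀ f, ι (θ f) = x • f :=
    ⟨{ toFun := t
       map_add' := fun a b => hι (by simp [ht])
       map_smul' := fun a b => hι (by simp [ht, smul_comm x a b]) }, ht⟩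
  obtain ⟨θ, hθ⟩ := hθ
  have hker : LinearMap.ker p ≤ LinearMap.ker (qK ∘ₗ θ) := by
    intro f hf
    obtain ⟨k, rfl⟩ := (hιp f).1 hf
    rw [LinearMap.mem_ker, LinearMap.comp_apply, hqK.ker]
    exact ⟨k, hι (by rw [hθ, map_smul])⟩
  let e := p.quotKerEquivOfSurjective hp
  let j₀ : M →ₗ[B] K' := (LinearMap.ker p).liftQ (qK ∘ₗ θ) hker ∘ₗ e.symm.toLinearMap
  let j : M →ₗ[A] K' := j₀.extendScalarsOfSurjective hs
  have hj : ∀ f, j (p f) = qK (θ f) := by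
    intro f
    change (LinearMap.ker p).liftQ (qK ∘ₗ θ) hker (e.symm (p f)) = _
    have : e.symm (p f) = Submodule.Quotient.mk f := by
      rw [LinearEquiv.symm_apply_eq]; rfl
    rw [this]; rfl
  have hπ : ∀ y, ι' y ∈ LinearMap.ker p' := by
    intro y
    obtain ⟨k, rfl⟩ := hqK.surj y
    rw [LinearMap.mem_ker, hι', hp', hιp.apply_apply_eq_zero]
  refine ⟨p', j, ι'.codRestrict _ hπ, ?_, ?_, ?_, ?_⟩
  · intro m
    obtain ⟨f, rfl⟩ := hp m
    exact ⟨qF f, hp' f⟩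
  · intro y
    obtain ⟨k, rfl⟩ := hqK.surj y
    rw [← Subtype.val_inj]
    change ι' (qK k) = 0 ↔ _
    rw [hι', hqF.ker]
    constructor
    · rintro ⟨f, hf⟩
      refine ⟨p f, ?_⟩
      rw [hj]
      exact congrArg qK (hι (by rw [hθ, hf]))
    · rintro ⟨m, hm⟩
      obtain ⟨f, rfl⟩ := hp m
      rw [hj, ← sub_eq_zero, ← map_sub, hqK.ker] at hm
      obtain ⟨k', hk'⟩ := hm
      refine ⟨f - ι k', ?_⟩
      have := congrArg ι hk'
      rw [map_sub, hθ, map_smul] at this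
      rw [smul_sub, ← this, sub_sub_cancel]
  · rw [injective_iff_map_eq_zero]
    intro m hm
    obtain ⟨f, rfl⟩ := hp m
    rw [hj, hqK.ker] at hm
    obtain ⟨k', hk'⟩ := hm
    have := congrArg ι hk'
    rw [hθ, map_smul] at this
    rw [hxF this, hιp.apply_apply_eq_zero]
  · rintro ⟨y, hy⟩
    obtain ⟨f, rfl⟩ := hqF.surj y
    rw [LinearMap.mem_ker, hp'] at hy
    obtain ⟨k, rfl⟩ := (hιp f).1 hy
    exact ⟨qK k, Subtype.ext (hι' k)⟩

theorem step_a [IsNoetherianRing B] [IsNoetherianRing A]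
    (hs : Function.Surjective (algebraMap B A))
    (hk : ∀ b, algebraMap B A b = 0 ↔ ∃ b', b = x * b') (hx : IsSMulRegular B x)
    (hB : SA B) (M : Type) [AddCommGroup M] [Module A M] [Module.Finite A M] (n : ℕ)
    (hM : ∀ i, n ≤ i → vx A M M i) : ∃ m, HasProjectiveDimensionLT (ModuleCat.of A M) m := by
  have hx0 : algebraMap B A x = 0 := (hk x).2 ⟨1, by simp⟩
  let _ : Module B M := Module.compHom M (algebraMap B A)
  have : IsScalarTower B A M := IsScalarTower.of_algebraMap_smul fun _ _ => rfl
  have : Module.Finite B A := Module.Finite.of_surjective (Algebra.linearMap B A) hs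
  have : Module.Finite B M := Module.Finite.trans A M
  obtain ⟨F, _, _, _, _, p, hp⟩ := Module.exists_finite_presentation B M
  obtain ⟨F', _, _, _, _, qF, hqF⟩ := exists_red hs hk F
  obtain ⟨K', _, _, _, _, qK, hqK⟩ := exists_red hs hk (LinearMap.ker p)
  have := hqF.projective hs hx0
  have hxF := regular_free hx F
  have hxK := regular_sub (LinearMap.ker p).subtype Subtype.val_injective hxF
  obtain ⟨p', j, π, hp', h1, hj, hπ⟩ := four_term hs hx0 hxF p.exact_subtype_ker_map
    Subtype.val_injective hp hqF hqK
  have hL : ∀ i, n ≤ i → 1 ≤ i → vx A (LinearMap.ker p') M i := by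
    intro i hi hi1
    obtain ⟨i, rfl⟩ : ∃ i', i = i' + 1 := ⟨i - 1, by omega⟩
    exact con1 p'.exact_subtype_ker_map Subtype.val_injective hp' (vx_proj i) (hM _ (by omega))
  have hK' : ∀ i, n ≤ i → vx A K' M (i + 1) := fun i hi =>
    con2 h1 hj hπ (hM _ (by omega)) (hL _ (by omega) (by omega))
  have hMB : ∀ i, n + 2 ≤ i → vx B M M i := by
    intro i hi
    obtain ⟨i, rfl⟩ : ∃ i', i = i' + 1 + 1 := ⟨i - 2, by omega⟩
    exact con3 p.exact_subtype_ker_map Subtype.val_injective hp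
      (alpha hs hk hx i hxK hqK (hK' i (by omega))) (vx_proj _)
  obtain ⟨m, hm⟩ := hB.1 M ⟨_, hMB⟩
  have s1 := sc_exact p.exact_subtype_ker_map Subtype.val_injective hp
  have p1 : Projective (ModuleCat.of B F) := (IsProjective.iff_projective F).1 inferInstance
  have hK : HasProjectiveDimensionLT (ModuleCat.of B (LinearMap.ker p)) (m + 1) :=
    (s1.hasProjectiveDimensionLT_X₃_iff m p1).1
      (hasProjectiveDimensionLT_of_ge (ModuleCat.of B M) m (m + 2) (by omega))
  have hKA := beta hs hk hx m hxK hqK hK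
  obtain ⟨χ, hχ⟩ := chi_inj h1 hj hπ p'.exact_subtype_ker_map Subtype.val_injective hp' (m + 1) hKA
  exact ⟨m + 1, chi_pd χ hχ hM⟩

end stepa

section stepb
variable {A B : Type} [CommRing A] [CommRing B] [Algebra B A] {x : B}

theorem red_exact {F F' : Type} [AddCommGroup F] [AddCommGroup F'] [Module B F] [Module B F']
    {q : F →ₗ[B] F'} (hq : IsRed x q) : Function.Exact (x • (LinearMap.id : F →ₗ[B] F)) q := by
  intro y
  rw [hq.ker]
  exact ⟨fun ⟨a, h⟩ => ⟨a, h.symm⟩, fun ⟨a, h⟩ => ⟨a, h.symm⟩⟩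

theorem lift_b {F F' N P N' : Type} [AddCommGroup F] [AddCommGroup F'] [AddCommGroup N]
    [AddCommGroup P] [AddCommGroup N'] [Module B F] [Module B F'] [Module B N] [Module B P]
    [Module B N'] {q : F →ₗ[B] F'} (hq : IsRed x q) (hxF : IsSMulRegular F x)
    {i : N' →ₗ[B] P} {p : P →ₗ[B] N} (hip : Function.Exact i p) (hi : Function.Injective i)
    (hp : Function.Surjective p) (hP : ∀ y : P, x • y = 0)
    (hN : vx B N F 2) (φ : N' →ₗ[B] F') : ∃ ψ : P →ₗ[B] F', ψ ∘ₗ i = φ := by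
  have s := sc_exact (red_exact hq) hxF hq.surj
  have s' := sc_exact hip hi hp
  obtain ⟨β, hβ⟩ := Ext.contravariant_sequence_exact₁ s' (ModuleCat.of B F)
    ((Ext.mk₀ (ModuleCat.ofHom φ)).comp s.extClass (zero_add 1)) rfl (vx_zero hN _)
  have hxβ : β.comp (Ext.mk₀ (ModuleCat.ofHom (x • (LinearMap.id : F →ₗ[B] F))))
      (add_zero 1) = 0 := by
    have h1 := comp_smul_id x β
    have h2 := smul_id_comp x β
    have h3 : x • 𝟙 (ModuleCat.of B P) = 0 := by
      ext y; exact hP y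
    have h4 : (Ext.mk₀ (x • 𝟙 (ModuleCat.of B P))).comp β (zero_add 1) = 0 := by
      rw [h3, Ext.mk₀_zero, Ext.zero_comp]
    exact h1.trans (h2.symm.trans h4)
  obtain ⟨y, hy⟩ := Ext.covariant_sequence_exact₁ _ s β hxβ rfl
  obtain ⟨ψ, rfl⟩ := (Ext.mk₀_bijective _ _).2 y
  refine ⟨ψ.hom, ?_⟩
  have h0 : (Ext.mk₀ (ModuleCat.ofHom i ≫ ψ - ModuleCat.ofHom φ)).comp s.extClass
      (zero_add 1) = 0 := by
    have hsub : ModuleCat.ofHom i ≫ ψ - ModuleCat.ofHom φ =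
        ModuleCat.ofHom i ≫ ψ + -ModuleCat.ofHom φ := sub_eq_add_neg _ _
    rw [hsub, Ext.mk₀_add, Ext.mk₀_neg, Ext.add_comp, Ext.neg_comp, ← sub_eq_add_neg,
      sub_eq_zero, ← Ext.mk₀_comp_mk₀]
    refine Eq.trans ?_ hβ
    rw [Ext.comp_assoc_of_second_deg_zero]
    exact congrArg (fun z => (Ext.mk₀ (ModuleCat.ofHom i)).comp z (zero_add 1)) hy
  obtain ⟨z, hz⟩ := Ext.covariant_sequence_exact₃ _ s _ rfl h0
  obtain ⟨ζ, rfl⟩ := (Ext.mk₀_bijective _ _).2 z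
  have hζ : ζ = 0 := by
    ext n
    refine hxF ?_
    have : x • n = 0 := hi (by rw [map_smul, hP, map_zero])
    change x • ζ.hom n = x • (0 : F)
    rw [← map_smul, smul_zero]
    rw [this, map_zero]
  rw [hζ, Ext.mk₀_zero, Ext.zero_comp, eq_comm, ← Ext.mk₀_zero,
    (Ext.mk₀_bijective _ _).1.eq_iff, sub_eq_zero] at hz
  exact congrArg ModuleCat.Hom.hom hz

theorem core_b [IsNoetherianRing B] [IsNoetherianRing A]
    (hs : Function.Surjective (algebraMap B A))
    (hk : ∀ b, algebraMap B A b = 0 ↔ ∃ b', b = x * b') (hx : IsSMulRegular B x)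
    {F F' : Type} [AddCommGroup F] [AddCommGroup F'] [Module B F] [Module B F'] [Module A F']
    [IsScalarTower B A F'] [Module.Free B F] {q : F →ₗ[B] F'} (hq : IsRed x q) (n : ℕ)
    {N : Type} [AddCommGroup N] [Module A N] [Module B N] [IsScalarTower B A N]
    [Module.Finite A N] (h : vx B N F (n + 2)) : vx A N F' (n + 1) := by
  have hx0 : algebraMap B A x = 0 := (hk x).2 ⟨1, by simp⟩
  have hfA : Module.Finite B A := Module.Finite.of_surjective (Algebra.linearMap B A) hs
  have hxF := regular_free hx F
  induction n generalizing N with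
  | zero =>
    have : Module.Finite B N := Module.Finite.trans A N
    obtain ⟨P, _, _, _, _, p, hp⟩ := Module.exists_finite_presentation B N
    obtain ⟨P', _, _, _, _, qP, hqP⟩ := exists_red hs hk P
    have := hqP.projective hs hx0
    obtain ⟨p', hp'q⟩ := hqP.lift hs hx0 p
    have hp' : Function.Surjective p' := by
      intro y
      obtain ⟨z, rfl⟩ := hp y
      exact ⟨_, hp'q z⟩
    refine vx_of_ext p'.exact_subtype_ker_map Subtype.val_injective hp' (vx_proj 0) fun φ => ?_
    obtain ⟨ψ, hψ⟩ := lift_b hq hxF (i := (LinearMap.ker p').subtype.restrictScalars B)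
      (p := p'.restrictScalars B) p'.exact_subtype_ker_map Subtype.val_injective hp'
      (fun y => x_smul_zero hx0 y) h (φ.restrictScalars B)
    exact ⟨ψ.extendScalarsOfSurjective hs, LinearMap.ext fun k => LinearMap.congr_fun hψ k⟩
  | succ n ih =>
    have : Module.Finite B N := Module.Finite.trans A N
    obtain ⟨P, _, _, _, _, p, hp⟩ := Module.exists_finite_presentation B N
    obtain ⟨P', _, _, _, _, qP, hqP⟩ := exists_red hs hk P
    have := hqP.projective hs hx0
    have := hqP.finite (A := A)
    obtain ⟨p', hp'q⟩ := hqP.lift hs hx0 p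
    have hp' : Function.Surjective p' := by
      intro y
      obtain ⟨z, rfl⟩ := hp y
      exact ⟨_, hp'q z⟩
    have h1 : vx B P' F (n + 2) :=
      con3 (red_exact hqP) (regular_free hx P) hqP.surj (vx_proj n) (vx_proj (n + 1))
    have h2 : vx B (LinearMap.ker p') F (n + 2) :=
      con1 (f := (LinearMap.ker p').subtype.restrictScalars B)
      (g := p'.restrictScalars B) p'.exact_subtype_ker_map Subtype.val_injective hp' h1 h
    exact con3 p'.exact_subtype_ker_map Subtype.val_injective hp' (ih h2) (vx_proj _)

theorem step_b [IsNoetherianRing B] [IsNoetherianRing A]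
    (hs : Function.Surjective (algebraMap B A))
    (hk : ∀ b, algebraMap B A b = 0 ↔ ∃ b', b = x * b') (hx : IsSMulRegular B x)
    (n : ℕ) (hB : ∀ (N Y : Type) [AddCommGroup N] [Module B N] [Module.Finite B N]
    [AddCommGroup Y] [Module B Y] [Module.Finite B Y] [Module.Projective B Y],
    ∀ i, n ≤ i → vx B N Y i) (N Y : Type) [AddCommGroup N] [Module A N] [Module.Finite A N]
    [AddCommGroup Y] [Module A Y] [Module.Finite A Y] [Module.Projective A Y] (i : ℕ)
    (hi : n + 1 ≤ i) : vx A N Y i := by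
  have hx0 : algebraMap B A x = 0 := (hk x).2 ⟨1, by simp⟩
  have hfA : Module.Finite B A := Module.Finite.of_surjective (Algebra.linearMap B A) hs
  let _ : Module B N := Module.compHom N (algebraMap B A)
  have : IsScalarTower B A N := IsScalarTower.of_algebraMap_smul fun _ _ => rfl
  let _ : Module B Y := Module.compHom Y (algebraMap B A)
  have : IsScalarTower B A Y := IsScalarTower.of_algebraMap_smul fun _ _ => rfl
  have : Module.Finite B N := Module.Finite.trans A N
  have : Module.Finite B Y := Module.Finite.trans A Y
  obtain ⟨F, _, _, _, _, p, hp⟩ := Module.exists_finite_presentation B Y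
  obtain ⟨F', _, _, _, _, qF, hqF⟩ := exists_red hs hk F
  obtain ⟨p', hp'q⟩ := hqF.lift hs hx0 p
  have hp' : Function.Surjective p' := by
    intro y
    obtain ⟨z, rfl⟩ := hp y
    exact ⟨_, hp'q z⟩
  obtain ⟨s, hs'⟩ := Module.projective_lifting_property p' LinearMap.id hp'
  obtain ⟨i, rfl⟩ : ∃ i', i = i' + 1 := ⟨i - 1, by omega⟩
  exact vx_retract_right s p' hs' (core_b hs hk hx hqF i (hB N F _ (by omega)))

theorem SA_step [IsNoetherianRing B] [IsNoetherianRing A]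
    (hs : Function.Surjective (algebraMap B A))
    (hk : ∀ b, algebraMap B A b = 0 ↔ ∃ b', b = x * b') (hx : IsSMulRegular B x)
    (hB : SA B) : SA A := by
  refine ⟨fun M _ _ _ ⟨n, hn⟩ => step_a hs hk hx hB M n hn, ?_⟩
  obtain ⟨n, hn⟩ := hB.2
  exact ⟨n + 1, fun N Y _ _ _ _ _ _ _ i hi => step_b hs hk hx n hn N Y i hi⟩

end stepb

section final

theorem SA_list {Q : Type} [CommRing Q] [IsLocalRing Q] [IsNoetherianRing Q]
    (hQ : IsRegularLocal Q) (gs : List Q) (hgs : RingTheory.Sequence.IsWeaklyRegular Q gs)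
    (A : Type) [CommRing A] [Algebra Q A] (hs : Function.Surjective (algebraMap Q A))
    (hk : ∀ q, algebraMap Q A q = 0 ↔ q ∈ Ideal.ofList gs) : SA A := by
  induction gs using List.reverseRecOn generalizing A with
  | nil =>
    refine SA_base' hQ ⟨?_, hs⟩
    rw [injective_iff_map_eq_zero]
    intro q hq
    simpa using (hk q).1 hq
  | append_singleton gs x ih =>
    rw [RingTheory.Sequence.isWeaklyRegular_append_iff] at hgs
    have hB := ih hgs.1 (Q ⧸ Ideal.ofList gs) Ideal.Quotient.mk_surjective
      (fun q => Ideal.Quotient.eq_zero_iff_mem)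
    have hle : ∀ q ∈ Ideal.ofList gs, algebraMap Q A q = 0 := by
      intro q hq
      rw [hk, Ideal.ofList_append]
      exact Ideal.mem_sup_left hq
    let _ : Algebra (Q ⧸ Ideal.ofList gs) A :=
      (Ideal.Quotient.lift (Ideal.ofList gs) (algebraMap Q A) hle).toAlgebra
    have hmap : ∀ q, algebraMap (Q ⧸ Ideal.ofList gs) A (Ideal.Quotient.mk _ q) =
      algebraMap Q A q := fun q => rfl
    have : IsNoetherianRing A := isNoetherianRing_of_surjective Q A (algebraMap Q A) hs
    refine SA_step (B := Q ⧸ Ideal.ofList gs) (x := Ideal.Quotient.mk _ x) ?_ ?_ ?_ hB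
    · intro a
      obtain ⟨q, rfl⟩ := hs a
      exact ⟨_, hmap q⟩
    · intro b
      obtain ⟨q, rfl⟩ := Ideal.Quotient.mk_surjective b
      rw [hmap, hk, Ideal.ofList_append, Ideal.ofList_singleton]
      constructor
      · intro h
        obtain ⟨a, ha, b, hb, rfl⟩ := Submodule.mem_sup.1 h
        obtain ⟨c, rfl⟩ := Ideal.mem_span_singleton'.1 hb
        refine ⟨Ideal.Quotient.mk _ c, ?_⟩
        rw [map_add, Ideal.Quotient.eq_zero_iff_mem.2 ha, zero_add, map_mul, mul_comm]
      · rintro ⟨c, hc⟩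
        obtain ⟨c, rfl⟩ := Ideal.Quotient.mk_surjective c
        rw [← map_mul, Ideal.Quotient.eq] at hc
        have := Submodule.add_mem_sup hc
          (Ideal.mul_mem_right c _ (Ideal.mem_span_singleton_self x))
        simpa using this
    · have h2 := hgs.2
      rw [RingTheory.Sequence.isWeaklyRegular_singleton_iff] at h2
      have e : (Q ⧸ (Ideal.ofList gs • ⊤ : Submodule Q Q)) ≃ₗ[Q] (Q ⧸ Ideal.ofList gs) :=
        Submodule.quotEquivOfEq _ _ (by simp)
      rw [e.isSMulRegular_congr] at h2
      intro a b hab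
      refine h2 ?_
      change Ideal.Quotient.mk _ x * a = Ideal.Quotient.mk _ x * b at hab
      change x • a = x • b
      rw [Algebra.smul_def, Algebra.smul_def]
      exact hab

theorem pd_to_vx {A : Type} [CommRing A] [IsNoetherianRing A] {n : ℕ} {k : Type} [AddCommGroup k]
    [Module A k] [Module.Finite A k]
    (hn : ∀ (N Y : Type) [AddCommGroup N] [Module A N] [Module.Finite A N]
    [AddCommGroup Y] [Module A Y] [Module.Finite A Y] [Module.Projective A Y],
    ∀ i, n ≤ i → vx A N Y i) (m : ℕ) (M : Type) [AddCommGroup M] [Module A M] [Module.Finite A M]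
    (hM : HasProjectiveDimensionLT (ModuleCat.of A M) (m + 1)) : ∀ i, n ≤ i → vx A k M i := by
  induction m generalizing M with
  | zero =>
    rw [zero_add, ← projective_iff_hasProjectiveDimensionLT_one] at hM
    have : Module.Projective A M := (IsProjective.iff_projective M).2 hM
    exact hn k M
  | succ m ih =>
    obtain ⟨F, _, _, _, _, p, hp⟩ := Module.exists_finite_presentation A M
    have s1 := sc_exact p.exact_subtype_ker_map Subtype.val_injective hp
    have p1 : Projective (ModuleCat.of A F) := (IsProjective.iff_projective F).1 inferInstance
    have h1 := ih (LinearMap.ker p) ((s1.hasProjectiveDimensionLT_X₃_iff m p1).1 hM)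
    intro i hi
    exact cov3 p.exact_subtype_ker_map Subtype.val_injective hp (h1 _ (by omega)) (hn k F i hi)

theorem final {A : Type} [CommRing A] [IsNoetherianRing A] [IsLocalRing A] (hA : SA A)
    {M k : Type} [AddCommGroup M] [Module A M] [Module.Finite A M] [AddCommGroup k] [Module A k]
    (e : k ≃ₗ[A] (A ⧸ maximalIdeal A)) :
    ((∃ n, ∀ i, n ≤ i → vx A M M i) ↔ ∃ n, ∀ i, n ≤ i → vx A k M i) ∧
    ((∃ n, ∀ i, n ≤ i → vx A k M i) ↔ ∃ n, ∀ i, n ≤ i → vx A M k i) := by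
  have hfk : Module.Finite A k := Module.Finite.equiv e.symm
  have h21 : (∃ n, ∀ i, n ≤ i → vx A k M i) → ∃ n, ∀ i, n ≤ i → vx A M M i :=
    fun ⟨n, hn⟩ => ⟨n, bass n (fun i hi => vx_congr_left e.symm (hn i hi)) M⟩
  have h31 : (∃ n, ∀ i, n ≤ i → vx A M k i) → ∃ n, ∀ i, n ≤ i → vx A M M i :=
    fun ⟨n, hn⟩ => ⟨n, bass' n (fun i hi => vx_congr_right e.symm (hn i hi)) M⟩
  have h13 : (∃ n, ∀ i, n ≤ i → vx A M M i) → ∃ n, ∀ i, n ≤ i → vx A M k i := by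
    intro h
    obtain ⟨m, hm⟩ := hA.1 M h
    exact ⟨m, fun i hi => pd_vx hm hi⟩
  have h12 : (∃ n, ∀ i, n ≤ i → vx A M M i) → ∃ n, ∀ i, n ≤ i → vx A k M i := by
    intro h
    obtain ⟨m, hm⟩ := hA.1 M h
    obtain ⟨n, hn⟩ := hA.2
    exact ⟨n, pd_to_vx hn m M (hasProjectiveDimensionLT_of_ge (ModuleCat.of A M) m (m + 1)
      (by omega))⟩
  exact ⟨⟨h12, h21⟩, ⟨fun h => h13 (h21 h), fun h => h12 (h31 h)⟩⟩

theorem extInf_iff {A X Y : Type} [CommRing A] [AddCommGroup X] [AddCommGroup Y] (mX : Module A X)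
    (mY : Module A Y) : extInf A X Y mX mY ↔ ¬ ∃ n, ∀ i, n ≤ i → vx A X Y i := by
  unfold extInf
  constructor
  · rintro h ⟨n, hn⟩
    obtain ⟨i, hi, hi'⟩ := h (n + 1)
    have := (vx_iff_ext (A := A) (X := X) (Y := Y) i (by omega)).2 (hn i (by omega))
    exact not_subsingleton_iff_nontrivial.2 hi' this
  · intro h n
    by_contra hn
    refine h ⟨n + 1, fun i hi => (vx_iff_ext i (by omega)).1 ?_⟩
    by_contra hc
    exact hn ⟨i, by omega, not_subsingleton_iff_nontrivial.1 hc⟩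

theorem k_equiv {Q : Type} [CommRing Q] [IsLocalRing Q] (J : Ideal Q) (hJ : J ≤ maximalIdeal Q)
    [IsLocalRing (Q ⧸ J)] :
    letI := kMod J hJ
    Nonempty ((Q ⧸ maximalIdeal Q) ≃ₗ[Q ⧸ J] ((Q ⧸ J) ⧸ maximalIdeal (Q ⧸ J))) := by
  letI := kMod J hJ
  let θ : (Q ⧸ J) →ₗ[Q ⧸ J] (Q ⧸ maximalIdeal Q) := LinearMap.toSpanSingleton _ _ 1
  have hθ : ∀ q : Q, θ (Ideal.Quotient.mk J q) = Ideal.Quotient.mk (maximalIdeal Q) q := by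
    intro q
    have h1 : θ (Ideal.Quotient.mk J q) = q • (1 : Q ⧸ maximalIdeal Q) := rfl
    rw [h1, Algebra.smul_def, mul_one]; rfl
  have hsurj : Function.Surjective θ := by
    intro y
    obtain ⟨q, rfl⟩ := Ideal.Quotient.mk_surjective y
    exact ⟨_, hθ q⟩
  have hker : LinearMap.ker θ = maximalIdeal (Q ⧸ J) := by
    refine le_antisymm (IsLocalRing.le_maximalIdeal fun h => ?_) fun a ha => ?_
    · have h1 : (1 : Q ⧸ J) ∈ LinearMap.ker θ := by rw [h]; trivial
      rw [LinearMap.mem_ker, ← map_one (Ideal.Quotient.mk J), hθ, map_one] at h1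
      exact one_ne_zero h1
    · obtain ⟨q, rfl⟩ := Ideal.Quotient.mk_surjective a
      rw [LinearMap.mem_ker, hθ, Ideal.Quotient.eq_zero_iff_mem]
      intro hq
      exact ha (hq.map (Ideal.Quotient.mk J))
  exact ⟨(θ.quotKerEquivOfSurjective hsurj).symm.trans (Submodule.quotEquivOfEq _ _ hker)⟩

end final

end HelperLemmas

/-- `V_R^d(M,M) = V_R^d(k,M) = V_R^d(M)`, pointwise. -/
theorem statement6
    (Q : Type) [CommRing Q] [IsLocalRing Q] [IsNoetherianRing Q]
    (hQreg : IsRegularLocal Q)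
    (c : ℕ) (hc : 1 ≤ c) (f : Fin c → Q)
    (hfreg : RingTheory.Sequence.IsRegular Q (List.ofFn f))
    (I : Ideal Q) (hIf : I = Ideal.span (Set.range f))
    (hIsq : I ≤ maximalIdeal Q ^ 2)
    (M : Type) [AddCommGroup M] [Module Q M] [Module.Finite Q M]
    (hM : Module.IsTorsionBySet Q M (I : Set Q))
    (d : ℕ) (g : Fin d → Q)
    (hgreg : RingTheory.Sequence.IsRegular Q (List.ofFn g))
    (hglin : LinIndepInV Q I g)
    (J : Ideal Q) (hJg : J = Ideal.span (Set.range g)) (hJI : J ≤ I)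
 :
    (extInf (Q ⧸ J) M M (modOver J hJI M hM) (modOver J hJI M hM) ↔
      extInf (Q ⧸ J) (Q ⧸ maximalIdeal Q) M (kMod J (hJI.trans (hIsq.trans (Ideal.pow_le_self two_ne_zero)))) (modOver J hJI M hM)) ∧
    (extInf (Q ⧸ J) (Q ⧸ maximalIdeal Q) M (kMod J (hJI.trans (hIsq.trans (Ideal.pow_le_self two_ne_zero)))) (modOver J hJI M hM) ↔
      extInf (Q ⧸ J) M (Q ⧸ maximalIdeal Q) (modOver J hJI M hM) (kMod J (hJI.trans (hIsq.trans (Ideal.pow_le_self two_ne_zero))))) := by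
  have hJm : J ≤ maximalIdeal Q := hJI.trans (hIsq.trans (Ideal.pow_le_self two_ne_zero))
  have : Nontrivial (Q ⧸ J) := Ideal.Quotient.nontrivial_iff.2
    (ne_top_of_le_ne_top (Ideal.IsPrime.ne_top inferInstance) hJm)
  have : IsLocalRing (Q ⧸ J) :=
    IsLocalRing.of_surjective' (Ideal.Quotient.mk J) Ideal.Quotient.mk_surjective
  have hSA : SA (Q ⧸ J) := by
    refine SA_list hQreg (List.ofFn g) hgreg.1 (Q ⧸ J) Ideal.Quotient.mk_surjective fun q => ?_
    refine Ideal.Quotient.eq_zero_iff_mem.trans ?_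
    rw [hJg]
    have : Set.range g = {r | r ∈ List.ofFn g} := by
      ext r; simp [List.mem_ofFn]
    rw [this]
  letI mM := modOver J hJI M hM
  letI mk := kMod J hJm
  obtain ⟨e⟩ := k_equiv J hJm
  have htow : IsScalarTower Q (Q ⧸ J) M := (hM.mono' hJI).isScalarTower
  have hfin : Module.Finite (Q ⧸ J) M := Module.Finite.of_restrictScalars_finite Q (Q ⧸ J) M
  have key := final hSA (M := M) e
  rw [extInf_iff, extInf_iff, extInf_iff]
  exact ⟨not_congr key.1, not_congr key.2⟩
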